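/- There are uncountably many minor-closed classes of countable graphs that have no minor-universal element. That is, there exists an uncountable family of pairwise distinct minor-closed classes of countable graphs, none of which contains a graph U such that every graph in the class is a minor of U. -/

import Mathlib

/-- `H` is a minor of `G`: pairwise disjoint nonempty connected branch sets, one for each
vertex of `H`, with a `G`-edge between the branch sets of any two `H`-adjacent vertices. -/
def IsMinor {V : Type*} {W : Type*} (H : SimpleGraph V) (G : SimpleGraph W) : Prop :=
  ∃ B : V → Set W,
    (∀ v : V, (G.induce (B v)).Connected) ∧
    (∀ u v : V, u ≠ v → Disjoint (B u) (B v)) ∧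
    (∀ u v : V, H.Adj u v → ∃ x ∈ B u, ∃ y ∈ B v, G.Adj x y)

/-- A countable graph: a simple graph together with its (countable) vertex type. -/
structure CGraph where
  V : Type
  countable : Countable V
  graph : SimpleGraph V

/-- A class of countable graphs is minor-closed if it contains every countable graph that
is a minor of one of its members.  (Since isomorphic graphs are minors of one another,
such a class is in particular closed under isomorphism.) -/
def MinorClosed (C : Set CGraph) : Prop :=
  ∀ G ∈ C, ∀ H : CGraph, IsMinor H.graph G.graph → H ∈ C

/-- `C` has a minor-universal element: some `U ∈ C` containing every member of `C`
as a minor. -/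
def HasUniversal (C : Set CGraph) : Prop :=
  ∃ U ∈ C, ∀ G ∈ C, IsMinor G.graph U.graph

namespace SimpleGraph

variable {V W : Type*}

theorem induce_biUnion_connected {H : SimpleGraph V} {G : SimpleGraph W} {B : V → Set W}
    (hc : ∀ v, (G.induce (B v)).Connected)
    (ha : ∀ u v, H.Adj u v → ∃ x ∈ B u, ∃ y ∈ B v, G.Adj x y)
    {S : Set V} (hS : (H.induce S).Connected) :
    (G.induce (⋃ v ∈ S, B v)).Connected := by
  have inside : ∀ u ∈ S, ∀ x y (hx : x ∈ ⋃ v ∈ S, B v) (hy : y ∈ ⋃ v ∈ S, B v),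
      x ∈ B u → y ∈ B u → (G.induce (⋃ v ∈ S, B v)).Reachable ⟨x, hx⟩ ⟨y, hy⟩ := by
    intro u hu x y hx hy hxu hyu
    exact ((hc u).preconnected ⟨x, hxu⟩ ⟨y, hyu⟩).map
      (G.induceHomOfLE (Set.subset_biUnion_of_mem hu)).toHom
  have along : ∀ {u v : S}, (H.induce S).Walk u v →
      ∀ x y (hx : x ∈ ⋃ v ∈ S, B v) (hy : y ∈ ⋃ v ∈ S, B v),
      x ∈ B u → y ∈ B v → (G.induce (⋃ v ∈ S, B v)).Reachable ⟨x, hx⟩ ⟨y, hy⟩ := by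
    intro u v p
    induction p with
    | @nil u => exact inside u u.2
    | @cons u w v h _ ih =>
      intro x y hx hy hxu hyv
      obtain ⟨a, hau, b, hbw, hab⟩ := ha u w h
      have ha' : a ∈ ⋃ v ∈ S, B v := Set.mem_biUnion u.2 hau
      have hb' : b ∈ ⋃ v ∈ S, B v := Set.mem_biUnion w.2 hbw
      have hadj : (G.induce (⋃ v ∈ S, B v)).Adj ⟨a, ha'⟩ ⟨b, hb'⟩ := hab
      exact (inside u u.2 x a hx ha' hxu hau).trans
        (hadj.reachable.trans (ih b y hb' hy hbw hyv))
  obtain ⟨⟨s, hs⟩⟩ := hS.nonempty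
  obtain ⟨⟨x, hx⟩⟩ := (hc s).nonempty
  have : Nonempty ↥(⋃ v ∈ S, B v) := ⟨⟨x, Set.mem_biUnion hs hx⟩⟩
  refine ⟨?_⟩
  rintro ⟨y, hy⟩ ⟨z, hz⟩
  obtain ⟨u, hu, hyu⟩ := Set.mem_iUnion₂.1 hy
  obtain ⟨v, hv, hzv⟩ := Set.mem_iUnion₂.1 hz
  obtain ⟨p⟩ := hS.preconnected ⟨u, hu⟩ ⟨v, hv⟩
  exact along p y z hy hz hyu hzv

/-- The cone over `G`: a new vertex `none` adjacent to all vertices of `G`. -/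
def cone (G : SimpleGraph V) : SimpleGraph (Option V) where
  Adj x y := x ≠ y ∧ ∀ a b, x = some a → y = some b → G.Adj a b
  symm := ⟨fun _ _ h => ⟨h.1.symm, fun a b ha hb => (h.2 b a hb ha).symm⟩⟩
  loopless := ⟨fun _ h => h.1 rfl⟩

theorem cone_adj_some {G : SimpleGraph V} {a b : V} :
    G.cone.Adj (some a) (some b) ↔ G.Adj a b :=
  ⟨fun h => h.2 a b rfl rfl, fun h => ⟨fun e => h.ne (Option.some.inj e), by
    rintro _ _ ⟨⟩ ⟨⟩; exact h⟩⟩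

theorem cone_adj_none {G : SimpleGraph V} (a : V) : G.cone.Adj none (some a) :=
  ⟨by simp, by simp⟩

/-- The inclusion of `G` into its cone. -/
def someEmbedding (G : SimpleGraph V) : G ↪g G.cone where
  toFun := some
  inj' := Option.some_injective V
  map_rel_iff' := cone_adj_some

/-- The homomorphism between cones induced by an injective homomorphism. -/
def coneMap {G : SimpleGraph V} {H : SimpleGraph W} (f : G →g H)
    (hf : Function.Injective f) : G.cone →g H.cone where
  toFun := Option.map f
  map_rel' := by
    rintro x y ⟨hne, h⟩
    refine ⟨(Option.map_injective hf).ne hne, fun a b ha hb => ?_⟩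
    obtain ⟨a', rfl, rfl⟩ := Option.map_eq_some_iff.1 ha
    obtain ⟨b', rfl, rfl⟩ := Option.map_eq_some_iff.1 hb
    exact f.map_adj (h a' b' rfl rfl)

/-- The disjoint union of a family of graphs. -/
def disjointUnion {ι : Type*} {V : ι → Type*} (G : ∀ i, SimpleGraph (V i)) :
    SimpleGraph (Σ i, V i) where
  Adj x y := ∃ i a b, x = ⟨i, a⟩ ∧ y = ⟨i, b⟩ ∧ (G i).Adj a b
  symm := ⟨by rintro _ _ ⟨i, a, b, rfl, rfl, h⟩; exact ⟨i, b, a, rfl, rfl, h.symm⟩⟩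
  loopless := ⟨by
    rintro _ ⟨i, a, b, rfl, h, hab⟩
    obtain rfl := eq_of_heq (Sigma.mk.inj h).2
    exact hab.ne rfl⟩

/-- The inclusion of a graph into a disjoint union. -/
def sigmaMkEmbedding {ι : Type*} {V : ι → Type*} (G : ∀ i, SimpleGraph (V i)) (i : ι) :
    G i ↪g disjointUnion G where
  toFun := Sigma.mk i
  inj' := sigma_mk_injective
  map_rel_iff' := by
    intro a b
    constructor
    · rintro ⟨j, a', b', h1, h2, h⟩
      obtain ⟨rfl, h1⟩ := Sigma.mk.inj h1
      obtain rfl := eq_of_heq h1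
      obtain rfl := eq_of_heq (Sigma.mk.inj h2).2
      exact h
    · intro h
      exact ⟨i, a, b, rfl, rfl, h⟩

theorem disjointUnion_adj_fst {ι : Type*} {V : ι → Type*} {G : ∀ i, SimpleGraph (V i)}
    {x y : Σ i, V i} (h : (disjointUnion G).Adj x y) : x.1 = y.1 := by
  obtain ⟨i, a, b, rfl, rfl, -⟩ := h
  rfl

theorem disjointUnion_connected_fst {ι : Type*} {V : ι → Type*} {G : ∀ i, SimpleGraph (V i)}
    {S : Set (Σ i, V i)} (hS : ((disjointUnion G).induce S).Connected)
    {x y : Σ i, V i} (hx : x ∈ S) (hy : y ∈ S) : x.1 = y.1 := by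
  have walk_fst : ∀ {u v : S}, ((disjointUnion G).induce S).Walk u v → u.1.1 = v.1.1 := by
    intro u v p
    induction p with
    | nil => rfl
    | cons h _ ih => exact (disjointUnion_adj_fst h).trans ih
  obtain ⟨p⟩ := hS.preconnected ⟨x, hx⟩ ⟨y, hy⟩
  exact walk_fst p

end SimpleGraph

open SimpleGraph

section IsMinor

variable {V W X : Type*}

theorem IsMinor.of_injective {H : SimpleGraph V} {G : SimpleGraph W} (f : H →g G)
    (hf : Function.Injective f) : IsMinor H G := by
  refine ⟨fun v => {f v}, fun v => ?_, fun u v huv => ?_, fun u v h => ?_⟩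
  · exact ⟨Preconnected.of_subsingleton⟩
  · exact Set.disjoint_singleton.2 (hf.ne huv)
  · exact ⟨f u, rfl, f v, rfl, f.map_adj h⟩

theorem IsMinor.refl (G : SimpleGraph V) : IsMinor G G :=
  .of_injective Hom.id Function.injective_id

theorem disjoint_biUnion_of_disjoint {B : V → Set W} (hd : ∀ u v, u ≠ v → Disjoint (B u) (B v))
    {S T : Set V} (h : Disjoint S T) : Disjoint (⋃ v ∈ S, B v) (⋃ v ∈ T, B v) := by
  simp only [Set.disjoint_iUnion_left, Set.disjoint_iUnion_right]
  exact fun v hv u hu => hd _ _ (h.ne_of_mem hu hv)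

theorem IsMinor.trans {H : SimpleGraph V} {G : SimpleGraph W} {K : SimpleGraph X}
    (h₁ : IsMinor H G) (h₂ : IsMinor G K) : IsMinor H K := by
  obtain ⟨A, hAc, hAd, hAa⟩ := h₁
  obtain ⟨B, hBc, hBd, hBa⟩ := h₂
  refine ⟨fun v => ⋃ w ∈ A v, B w, fun v => induce_biUnion_connected hBc hBa (hAc v),
    fun u v huv => disjoint_biUnion_of_disjoint hBd (hAd u v huv), fun u v h => ?_⟩
  obtain ⟨x, hx, y, hy, hxy⟩ := hAa u v h
  obtain ⟨a, ha, b, hb, hab⟩ := hBa x y hxy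
  exact ⟨a, Set.mem_biUnion hx ha, b, Set.mem_biUnion hy hb, hab⟩

/-- A model of `H` whose branch sets lie in an induced copy of `G` is a model of `H` in `G`. -/
theorem IsMinor.of_subset_range {H : SimpleGraph V} {G : SimpleGraph W} {K : SimpleGraph X}
    (f : G ↪g K) {B : V → Set X} (hc : ∀ v, (K.induce (B v)).Connected)
    (hd : ∀ u v, u ≠ v → Disjoint (B u) (B v))
    (ha : ∀ u v, H.Adj u v → ∃ x ∈ B u, ∃ y ∈ B v, K.Adj x y)
    (hf : ∀ v, B v ⊆ Set.range f) : IsMinor H G := by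
  refine ⟨fun v => f ⁻¹' B v, fun v => ?_, fun u v huv => (hd u v huv).preimage f,
    fun u v h => ?_⟩
  · have e : G.induce (f ⁻¹' B v) ≃g K.induce (B v) :=
      { toEquiv := Equiv.ofBijective (fun x => ⟨f x.1, x.2⟩)
          ⟨fun x y h => Subtype.ext (f.injective (congrArg Subtype.val h)), fun ⟨y, hy⟩ => by
            obtain ⟨x, rfl⟩ := hf v hy
            exact ⟨⟨x, hy⟩, rfl⟩⟩
        map_rel_iff' := f.map_rel_iff }
    exact e.connected_iff.2 (hc v)
  · obtain ⟨x, hx, y, hy, hxy⟩ := ha u v h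
    obtain ⟨a, rfl⟩ := hf u hx
    obtain ⟨b, rfl⟩ := hf v hy
    exact ⟨a, hx, b, hy, f.map_rel_iff.1 hxy⟩

theorem IsMinor.top_of_cone {G : SimpleGraph V} (h : IsMinor G.cone G) :
    IsMinor (⊤ : SimpleGraph ℕ) G := by
  obtain ⟨B, hc, hd, ha⟩ := h
  let φ : Set V → Set V := fun S => ⋃ v ∈ S, B (some v)
  let A : ℕ → Set V := fun n => φ^[n] (B none)
  have hA : ∀ n, A (n + 1) = φ (A n) := fun n => Function.iterate_succ_apply' φ n _
  have hAc : ∀ n, (G.induce (A n)).Connected := by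
    intro n
    induction n with
    | zero => exact hc none
    | succ n ih =>
      rw [hA]
      exact induce_biUnion_connected (fun v => hc (some v))
        (fun u v h => ha _ _ (cone_adj_some.2 h)) ih
  have hlt : ∀ k m, Disjoint (A m) (A (m + k + 1)) ∧
      ∃ x ∈ A m, ∃ y ∈ A (m + k + 1), G.Adj x y := by
    intro k m
    induction m with
    | zero =>
      rw [zero_add, hA]
      refine ⟨?_, ?_⟩
      · simp only [φ, Set.disjoint_iUnion_right]
        exact fun v _ => hd _ _ (by simp)
      · obtain ⟨⟨v, hv⟩⟩ := (hAc k).nonempty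
        obtain ⟨x, hx, y, hy, hxy⟩ := ha none (some v) (cone_adj_none v)
        exact ⟨x, hx, y, Set.mem_biUnion hv hy, hxy⟩
    | succ m ih =>
      obtain ⟨hdis, x, hx, y, hy, hxy⟩ := ih
      rw [show m + 1 + k + 1 = (m + k + 1) + 1 by omega, hA, hA]
      refine ⟨disjoint_biUnion_of_disjoint
        (fun u v huv => hd _ _ ((Option.some_injective V).ne huv)) hdis, ?_⟩
      obtain ⟨a, ha', b, hb, hab⟩ := ha _ _ (cone_adj_some.2 hxy)
      exact ⟨a, Set.mem_biUnion hx ha', b, Set.mem_biUnion hy hb, hab⟩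
  refine ⟨A, hAc, fun m n hmn => ?_, fun m n hmn => ?_⟩
  · rcases hmn.lt_or_gt with h | h
    · obtain ⟨k, rfl⟩ := Nat.exists_eq_add_of_lt h
      exact (hlt k m).1
    · obtain ⟨k, rfl⟩ := Nat.exists_eq_add_of_lt h
      exact (hlt k n).1.symm
  · rcases hmn.ne.lt_or_gt with h | h
    · obtain ⟨k, rfl⟩ := Nat.exists_eq_add_of_lt h
      exact (hlt k m).2
    · obtain ⟨k, rfl⟩ := Nat.exists_eq_add_of_lt h
      obtain ⟨x, hx, y, hy, hxy⟩ := (hlt k n).2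
      exact ⟨y, hy, x, hx, hxy.symm⟩

theorem IsMinor.top_of_top_cone {G : SimpleGraph V} (h : IsMinor (⊤ : SimpleGraph ℕ) G.cone) :
    IsMinor (⊤ : SimpleGraph ℕ) G := by
  obtain ⟨B, hc, hd, ha⟩ := h
  obtain ⟨n₀, hn₀⟩ : ∃ n₀, ∀ n, none ∉ B (n₀ + 1 + n) := by
    by_cases h : ∃ n₀, none ∈ B n₀
    · obtain ⟨n₀, h⟩ := h
      exact ⟨n₀, fun n => Set.disjoint_left.1 (hd _ _ (by omega)) h⟩
    · exact ⟨0, fun n hn => h ⟨_, hn⟩⟩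
  refine .of_subset_range (someEmbedding G) (B := fun n => B (n₀ + 1 + n)) (fun n => hc _)
    (fun m n hmn => hd _ _ (by omega)) (fun m n hmn => ha _ _ ?_) (fun n x hx => ?_)
  · have := hmn.ne
    rw [top_adj]
    omega
  · cases x with
    | none => exact absurd hx (hn₀ n)
    | some a => exact ⟨a, rfl⟩

theorem IsMinor.exists_of_top_disjointUnion {ι : Type*} {V : ι → Type*}
    {G : ∀ i, SimpleGraph (V i)} (h : IsMinor (⊤ : SimpleGraph ℕ) (disjointUnion G)) :
    ∃ i, IsMinor (⊤ : SimpleGraph ℕ) (G i) := by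
  obtain ⟨B, hc, hd, ha⟩ := h
  obtain ⟨⟨z, hz⟩⟩ := (hc 0).nonempty
  refine ⟨z.1, .of_subset_range (sigmaMkEmbedding G z.1) hc hd ha fun n x hx => ?_⟩
  have hzx : z.1 = x.1 := by
    rcases eq_or_ne 0 n with rfl | hn
    · exact disjointUnion_connected_fst (hc 0) hz hx
    · obtain ⟨a, ha', b, hb, hab⟩ := ha 0 n hn
      exact (disjointUnion_connected_fst (hc 0) hz ha').trans
        ((disjointUnion_adj_fst hab).trans (disjointUnion_connected_fst (hc n) hb hx))
  obtain ⟨i, a⟩ := x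
  obtain rfl : z.1 = i := hzx
  exact ⟨a, rfl⟩

end IsMinor

/-- Countably many countable graphs without a `K_ω` minor have a common strict upper bound
without a `K_ω` minor. -/
theorem CGraph.exists_strict_bound (G : ℕ → CGraph)
    (hG : ∀ n, ¬ IsMinor (⊤ : SimpleGraph ℕ) (G n).graph) :
    ∃ U : CGraph, ¬ IsMinor (⊤ : SimpleGraph ℕ) U.graph ∧
      ∀ n, IsMinor (G n).graph U.graph ∧ ¬ IsMinor U.graph (G n).graph := by
  have : ∀ n, Countable (G n).V := fun n => (G n).countable
  let D := disjointUnion fun n => (G n).graph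
  refine ⟨⟨Option (Σ n, (G n).V), inferInstance, D.cone⟩, fun h => ?_, fun n => ⟨?_, fun h => ?_⟩⟩
  · obtain ⟨n, hn⟩ := h.top_of_top_cone.exists_of_top_disjointUnion
    exact hG n hn
  · let f : (G n).graph ↪g D.cone := (sigmaMkEmbedding _ n).trans (someEmbedding D)
    exact .of_injective f.toHom f.injective
  · let f := sigmaMkEmbedding (fun n => (G n).graph) n
    exact hG n (IsMinor.trans (.of_injective (coneMap f.toHom f.injective)
      (Option.map_injective f.injective)) h).top_of_cone

/-- There are uncountably many (pairwise distinct) minor-closed classes of countable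
graphs having no minor-universal element. -/
theorem uncountably_many_classes_without_universal :
    ∃ F : Set (Set CGraph), ¬ F.Countable ∧
      ∀ C ∈ F, MinorClosed C ∧ ¬ HasUniversal C := by
  let P := {G : CGraph // ¬ IsMinor (⊤ : SimpleGraph ℕ) G.graph}
  have bound : ∀ G : ℕ → P, ∃ U : P, ∀ n,
      IsMinor (G n).1.graph U.1.graph ∧ ¬ IsMinor U.1.graph (G n).1.graph := by
    intro G
    obtain ⟨U, hU, h⟩ := CGraph.exists_strict_bound (fun n => (G n).1) fun n => (G n).2
    exact ⟨⟨U, hU⟩, h⟩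
  have step : ∀ G : P, ∃ U : P,
      IsMinor G.1.graph U.1.graph ∧ ¬ IsMinor U.1.graph G.1.graph := fun G =>
    let ⟨U, h⟩ := bound fun _ => G
    ⟨U, h 0⟩
  choose next hnext hnext' using step
  let F : Set (Set CGraph) := {C | (MinorClosed C ∧ ¬ HasUniversal C) ∧
    ∃ U : P, ∀ G ∈ C, IsMinor G.graph U.1.graph}
  have tower : ∀ G : P, ∃ C ∈ F, G.1 ∈ C := by
    intro G
    let T : ℕ → P := fun n => next^[n] G
    have hT : ∀ n, T (n + 1) = next (T n) := fun n => Function.iterate_succ_apply' next n G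
    refine ⟨{H | ∃ n, IsMinor H.graph (T n).1.graph}, ⟨⟨?_, ?_⟩, ?_⟩, 0, .refl _⟩
    · rintro H ⟨n, hn⟩ K hK
      exact ⟨n, hK.trans hn⟩
    · rintro ⟨U, ⟨n, hn⟩, hU⟩
      have h := (hU (T (n + 1)).1 ⟨n + 1, .refl _⟩).trans hn
      rw [hT] at h
      exact hnext' _ h
    · obtain ⟨U, hU⟩ := bound T
      exact ⟨U, fun H ⟨n, hn⟩ => hn.trans (hU n).1⟩
  refine ⟨F, fun hF => ?_, fun C hC => hC.1⟩
  obtain ⟨e⟩ : Nonempty P := by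
    let E : CGraph := ⟨Empty, inferInstance, ⊥⟩
    refine ⟨⟨E, ?_⟩⟩
    rintro ⟨B, hc, -⟩
    obtain ⟨⟨x, -⟩⟩ := (hc 0).nonempty
    exact x.elim
  obtain ⟨C₀, hC₀, -⟩ := tower e
  obtain ⟨f, hf⟩ := hF.exists_eq_range ⟨C₀, hC₀⟩
  have hb : ∀ n, ∃ U : P, ∀ G ∈ f n, IsMinor G.graph U.1.graph := fun n =>
    (hf ▸ Set.mem_range_self n : f n ∈ F).2
  choose b hb using hb
  obtain ⟨U, hU⟩ := bound b
  obtain ⟨C, hC, hUC⟩ := tower U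
  obtain ⟨n, rfl⟩ : C ∈ Set.range f := hf ▸ hC
  exact (hU n).2 (hb n U.1 hUC)
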